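/- arXiv:math/0409470 — 2 statements merged into one kernel-verified Lean document; each statement's English description precedes it below -/
import Mathlib

section
/- Let n : ℕ, E = EuclideanSpace ℝ (Fin n), and let F, G : E × E → ℝ be smooth (ContDiff ℝ ⊤). Then for every r : ℕ and every x ∈ E × E, the Moyal bidifferential coefficients satisfy the parity relation C_r(F,G)(x) = (−1)^r · C_r(G,F)(x). In particular C_1(F,G) − C_1(G,F) = 2·C_1(F,G). -/
open scoped RealInnerProductSpace

/-- The phase space `E × E` over `E = EuclideanSpace ℝ (Fin n)`. -/
abbrev EucSp (n : ℕ) := EuclideanSpace ℝ (Fin n)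

/-- The orthonormal basis vectors `e_{(a,i)}` of `E × E`:
`e_{(0,i)} = (eᵢ, 0)` and `e_{(1,i)} = (0, eᵢ)`. -/
noncomputable def bvec (n : ℕ) (a : Fin 2) (i : Fin n) : EucSp n × EucSp n :=
  if a = 0 then (EuclideanSpace.single i (1 : ℝ), 0)
  else (0, EuclideanSpace.single i (1 : ℝ))

/-- The symplectic `2 × 2` matrix `Λ` with `Λ(1,2) = 1`, `Λ(2,1) = -1` and zero
on the diagonal (indices shifted to `Fin 2`). -/
def Lam : Fin 2 → Fin 2 → ℝ := fun a b =>
  if a = 0 ∧ b = 1 then 1 else if a = 1 ∧ b = 0 then -1 else 0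

/-- The `r`-th Moyal bidifferential coefficient
`C_r(F,G)(x) = Σ_{α,β,i} (∏_j Λ(α_j,β_j)) · D^rF(x)[e_{(α,i)}] · D^rG(x)[e_{(β,i)}]`.
For `r = 0` this reduces to the pointwise product `F·G`. -/
noncomputable def moyalC (n r : ℕ) (F G : EucSp n × EucSp n → ℝ)
    (x : EucSp n × EucSp n) : ℝ :=
  ∑ α : Fin r → Fin 2, ∑ β : Fin r → Fin 2, ∑ i : Fin r → Fin n,
    (∏ j, Lam (α j) (β j)) *
      (iteratedFDeriv ℝ r F x (fun j => bvec n (α j) (i j)) *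
        iteratedFDeriv ℝ r G x (fun j => bvec n (β j) (i j)))

theorem Lam_swap (a b : Fin 2) : Lam a b = -Lam b a := by
  fin_cases a <;> fin_cases b <;> simp [Lam]

theorem prod_Lam_swap {r : ℕ} (α β : Fin r → Fin 2) :
    ∏ j, Lam (α j) (β j) = (-1 : ℝ) ^ r * ∏ j, Lam (β j) (α j) := by
  simp_rw [fun j => Lam_swap (α j) (β j), Finset.prod_neg, Finset.card_univ, Fintype.card_fin]

theorem moyalC_swap (n r : ℕ) (F G : EucSp n × EucSp n → ℝ) (x : EucSp n × EucSp n) :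
    moyalC n r F G x = (-1 : ℝ) ^ r * moyalC n r G F x := by
  unfold moyalC
  rw [Finset.sum_comm]
  simp_rw [Finset.mul_sum]
  refine Finset.sum_congr rfl fun α _ => Finset.sum_congr rfl fun β _ =>
    Finset.sum_congr rfl fun i _ => ?_
  rw [prod_Lam_swap β α]
  ring

/-- Parity of the Moyal coefficients: `C_r(F,G) = (-1)^r C_r(G,F)`; in particular
`C_1(F,G) - C_1(G,F) = 2 C_1(F,G)`. -/
theorem moyalC_parity (n : ℕ) (F G : EucSp n × EucSp n → ℝ)
    (hF : ContDiff ℝ (⊤ : ℕ∞) F) (hG : ContDiff ℝ (⊤ : ℕ∞) G) :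
    (∀ (r : ℕ) (x : EucSp n × EucSp n),
        moyalC n r F G x = (-1 : ℝ) ^ r * moyalC n r G F x) ∧
      (∀ x : EucSp n × EucSp n,
        moyalC n 1 F G x - moyalC n 1 G F x = 2 * moyalC n 1 F G x) := by
  refine ⟨fun r x => moyalC_swap n r F G x, fun x => ?_⟩
  rw [moyalC_swap n 1 G F x]
  ring
end

section
/- Let n : ℕ, E = EuclideanSpace ℝ (Fin n), and let F, G : E × E → ℝ be smooth (ContDiff ℝ ⊤). Then for every x ∈ E × E, C_1(F,G)(x) = {F,G}(x), where {F,G}(x) = ⟪∇₁F(x), ∇₂G(x)⟫ − ⟪∇₁G(x), ∇₂F(x)⟫ is the canonical Poisson bracket; consequently C_1(F,G)(x) − C_1(G,F)(x) = 2{F,G}(x), i.e. the Moyal coefficients satisfy condition (iii) of a star product. -/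
open scoped RealInnerProductSpace

/-- Gradient of `F : E × E → ℝ` with respect to the first factor. -/
noncomputable def grad1 {E : Type*} [NormedAddCommGroup E] [InnerProductSpace ℝ E]
    [CompleteSpace E] (F : E × E → ℝ) (x : E × E) : E :=
  gradient (fun y => F (y, x.2)) x.1

/-- Gradient of `F : E × E → ℝ` with respect to the second factor. -/
noncomputable def grad2 {E : Type*} [NormedAddCommGroup E] [InnerProductSpace ℝ E]
    [CompleteSpace E] (F : E × E → ℝ) (x : E × E) : E :=
  gradient (fun y => F (x.1, y)) x.2

/-- The canonical Poisson bracket on `E × E`. -/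
noncomputable def poissonBracket {E : Type*} [NormedAddCommGroup E] [InnerProductSpace ℝ E]
    [CompleteSpace E] (F G : E × E → ℝ) (x : E × E) : ℝ :=
  ⟪grad1 F x, grad2 G x⟫ - ⟪grad1 G x, grad2 F x⟫

/-- The inner product of the first partial gradient with `v` is the derivative along `(v, 0)`. -/
theorem inner_grad1 {E : Type*} [NormedAddCommGroup E] [InnerProductSpace ℝ E]
    [CompleteSpace E] {F : E × E → ℝ} {x : E × E} (hF : DifferentiableAt ℝ F x) (v : E) :
    ⟪grad1 F x, v⟫ = fderiv ℝ F x (v, 0) := by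
  have h : HasFDerivAt (fun y => F (y, x.2))
      ((fderiv ℝ F x).comp (ContinuousLinearMap.inl ℝ E E)) x.1 :=
    HasFDerivAt.comp (g := F) x.1 hF.hasFDerivAt (hasFDerivAt_prodMk_left x.1 x.2)
  simp [grad1, gradient, h.fderiv]

/-- The inner product of the second partial gradient with `v` is the derivative along `(0, v)`. -/
theorem inner_grad2 {E : Type*} [NormedAddCommGroup E] [InnerProductSpace ℝ E]
    [CompleteSpace E] {F : E × E → ℝ} {x : E × E} (hF : DifferentiableAt ℝ F x) (v : E) :
    ⟪grad2 F x, v⟫ = fderiv ℝ F x (0, v) := by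
  have h : HasFDerivAt (fun y => F (x.1, y))
      ((fderiv ℝ F x).comp (ContinuousLinearMap.inr ℝ E E)) x.2 :=
    HasFDerivAt.comp (g := F) x.2 hF.hasFDerivAt (hasFDerivAt_prodMk_right x.1 x.2)
  simp [grad2, gradient, h.fderiv]

/-- The canonical Poisson bracket is antisymmetric. -/
theorem poissonBracket_swap {E : Type*} [NormedAddCommGroup E] [InnerProductSpace ℝ E]
    [CompleteSpace E] (F G : E × E → ℝ) (x : E × E) :
    poissonBracket G F x = -poissonBracket F G x := by
  simp [poissonBracket]

/-- The inner product of partial gradients, written in partial derivatives. -/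
theorem inner_grad1_grad2 {n : ℕ} {F G : EucSp n × EucSp n → ℝ} {x : EucSp n × EucSp n}
    (hF : DifferentiableAt ℝ F x) (hG : DifferentiableAt ℝ G x) :
    ⟪grad1 F x, grad2 G x⟫ =
      ∑ i, fderiv ℝ F x (bvec n 0 i) * fderiv ℝ G x (bvec n 1 i) := by
  rw [← (EuclideanSpace.basisFun (Fin n) ℝ).sum_inner_mul_inner]
  refine Finset.sum_congr rfl fun i _ => ?_
  rw [real_inner_comm (grad2 G x), inner_grad1 hF, inner_grad2 hG]
  simp [bvec]

/-- The first Moyal coefficient in terms of first derivatives. -/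
theorem moyalC_one (n : ℕ) (F G : EucSp n × EucSp n → ℝ) (x : EucSp n × EucSp n) :
    moyalC n 1 F G x =
      ∑ i, fderiv ℝ F x (bvec n 0 i) * fderiv ℝ G x (bvec n 1 i) -
        ∑ i, fderiv ℝ F x (bvec n 1 i) * fderiv ℝ G x (bvec n 0 i) := by
  have hsum {ι : Type} [Fintype ι] (f : (Fin 1 → ι) → ℝ) :
      ∑ a, f a = ∑ i, f fun _ => i :=
    Fintype.sum_equiv (Equiv.funUnique (Fin 1) ι) _ _ fun a =>
      congrArg f (funext fun j => congrArg a (Subsingleton.elim _ _))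
  simp [moyalC, hsum, Lam, iteratedFDeriv_one_apply, Fin.sum_univ_two, sub_eq_add_neg]

/-- The first Moyal coefficient of differentiable functions is their Poisson bracket. -/
theorem moyalC_one_eq_of_differentiableAt {n : ℕ} {F G : EucSp n × EucSp n → ℝ}
    {x : EucSp n × EucSp n} (hF : DifferentiableAt ℝ F x) (hG : DifferentiableAt ℝ G x) :
    moyalC n 1 F G x = poissonBracket F G x := by
  rw [moyalC_one, poissonBracket, inner_grad1_grad2 hF hG, inner_grad1_grad2 hG hF]
  simp only [mul_comm]

/-- The first Moyal coefficient is the canonical Poisson bracket: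
`C_1(F,G) = {F,G}`, hence `C_1(F,G) - C_1(G,F) = 2 {F,G}` (condition (iii) of a
star product). -/
theorem moyalC_one_eq_poissonBracket (n : ℕ) (F G : EucSp n × EucSp n → ℝ)
    (hF : ContDiff ℝ (⊤ : ℕ∞) F) (hG : ContDiff ℝ (⊤ : ℕ∞) G) (x : EucSp n × EucSp n) :
    moyalC n 1 F G x = poissonBracket F G x ∧
      moyalC n 1 F G x - moyalC n 1 G F x = 2 * poissonBracket F G x := by
  have hF' : DifferentiableAt ℝ F x := hF.differentiable (by simp) x
  have hG' : DifferentiableAt ℝ G x := hG.differentiable (by simp) x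
  rw [moyalC_one_eq_of_differentiableAt hF' hG', moyalC_one_eq_of_differentiableAt hG' hF',
    poissonBracket_swap F G x]
  exact ⟨rfl, by ring⟩
end
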